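/- If p^b ≤ X then I_1(X;a,b) ≤ I_2(X;b,a)^{1/4} · J(2X/p^b)^{3/4}. -/

import Mathlib

/-- `Jcount s k X` is the number of `2s`-tuples `(x₁,…,x_{2s})` of positive integers
with each `xᵢ ≤ X` satisfying `x₁ʲ+⋯+x_sʲ = x_{s+1}ʲ+⋯+x_{2s}ʲ` for all `1 ≤ j ≤ k`.
The tuple is encoded as a pair of `s`-tuples (the two sides of the system). -/
noncomputable def Jcount (s k : ℕ) (X : ℝ) : ℕ :=
  Nat.card {xy : (Fin s → ℕ) × (Fin s → ℕ) //
    (∀ i, 1 ≤ xy.1 i ∧ (xy.1 i : ℝ) ≤ X) ∧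
    (∀ i, 1 ≤ xy.2 i ∧ (xy.2 i : ℝ) ≤ X) ∧
    ∀ j ∈ Finset.Icc 1 k, ∑ i, xy.1 i ^ j = ∑ i, xy.2 i ^ j}

/-- `Icount p X m a b ξ η` is the number of 12-tuples `(x₁,…,x₆,x₇,…,x₁₂)` of positive
integers `≤ X` (encoded as a pair of 6-tuples) satisfying
`x₁ʲ+⋯+x₆ʲ = x₇ʲ+⋯+x₁₂ʲ` for `j = 1,2,3`, with `xᵢ ≡ ξ (mod pᵃ)` for
`1 ≤ i ≤ m` and `7 ≤ i ≤ 6+m`, and `xᵢ ≡ η (mod pᵇ)` for the remaining indices. -/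
noncomputable def Icount (p : ℕ) (X : ℝ) (m a b : ℕ) (ξ η : ℤ) : ℕ :=
  Nat.card {xy : (Fin 6 → ℕ) × (Fin 6 → ℕ) //
    (∀ i, 1 ≤ xy.1 i ∧ (xy.1 i : ℝ) ≤ X) ∧
    (∀ i, 1 ≤ xy.2 i ∧ (xy.2 i : ℝ) ≤ X) ∧
    (∀ j ∈ Finset.Icc 1 3, ∑ i, xy.1 i ^ j = ∑ i, xy.2 i ^ j) ∧
    (∀ i : Fin 6, if (i : ℕ) < m then (xy.1 i : ℤ) ≡ ξ [ZMOD (p : ℤ) ^ a]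
      else (xy.1 i : ℤ) ≡ η [ZMOD (p : ℤ) ^ b]) ∧
    (∀ i : Fin 6, if (i : ℕ) < m then (xy.2 i : ℤ) ≡ ξ [ZMOD (p : ℤ) ^ a]
      else (xy.2 i : ℤ) ≡ η [ZMOD (p : ℤ) ^ b])}

/-- `Imax p X m a b` : for `m = 0`, the maximum of `Icount p X 0 a b ξ η` over residues
`η mod pᵇ` (it is independent of `ξ`); for `1 ≤ m ≤ 5`, the maximum of
`Icount p X m a b ξ η` over residues `ξ mod pᵃ`, `η mod pᵇ` with `ξ ≢ η (mod p)`. -/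
noncomputable def Imax (p : ℕ) (X : ℝ) (m a b : ℕ) : ℕ :=
  if m = 0 then sSup {n : ℕ | ∃ η : ℤ, n = Icount p X 0 a b 0 η}
  else sSup {n : ℕ | ∃ ξ η : ℤ, ¬ ξ ≡ η [ZMOD (p : ℤ)] ∧ n = Icount p X m a b ξ η}

open Finset in
/-- Orthogonality of characters: the mean value of a product of squared exponential sums counts
solutions of the underlying additive equation. -/
theorem sum_prod_norm_sq_eq_card {ι A : Type*} [Fintype ι] [DecidableEq ι] [AddCommGroup A]
    [Fintype A] [DecidableEq A] (v : ℕ → A) (S : ι → Finset ℕ) :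
    ∑ ψ : AddChar A ℂ, ∏ i, ‖∑ x ∈ S i, ψ (v x)‖ ^ 2 =
      (Fintype.card A : ℝ) * #{z ∈ Fintype.piFinset S ×ˢ Fintype.piFinset S |
        ∑ i, v (z.1 i) = ∑ i, v (z.2 i)} := by
  have map_sum_eq : ∀ (ψ : AddChar A ℂ) (f : ι → A), ψ (∑ i, f i) = ∏ i, ψ (f i) :=
    fun ψ f => map_prod ψ.toMonoidHom (fun i => Multiplicative.ofAdd (f i)) univ
  have key : ∀ ψ : AddChar A ℂ, ((∏ i, ‖∑ x ∈ S i, ψ (v x)‖ ^ 2 : ℝ) : ℂ) =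
      ∑ z ∈ Fintype.piFinset S ×ˢ Fintype.piFinset S,
        ψ (∑ i, v (z.1 i) - ∑ i, v (z.2 i)) := by
    intro ψ
    push_cast
    simp_rw [← Complex.mul_conj', Finset.prod_mul_distrib, ← map_prod, Finset.prod_univ_sum,
      map_sum, map_prod, Finset.sum_mul_sum, Finset.sum_product, AddChar.map_sub_eq_div,
      map_sum_eq, ← AddChar.map_neg_eq_conj, AddChar.map_neg_eq_inv,
      Finset.prod_inv_distrib, div_eq_mul_inv]
  apply Complex.ofReal_injective
  rw [Complex.ofReal_sum]
  simp_rw [key]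
  rw [Finset.sum_comm]
  simp_rw [AddChar.sum_apply_eq_ite, sub_eq_zero]
  rw [Finset.sum_ite, Finset.sum_const_zero, add_zero, Finset.sum_const, nsmul_eq_mul]
  push_cast
  ring

/-- Hölder's inequality with exponents `4` and `4/3` for the moments of two functions. -/
theorem sum_sq_mul_pow_ten_le {ι : Type*} (s : Finset ι) (f g : ι → ℝ) (hf : ∀ i, 0 ≤ f i)
    (hg : ∀ i, 0 ≤ g i) :
    ∑ i ∈ s, f i ^ 2 * g i ^ 10 ≤
      (∑ i ∈ s, g i ^ 4 * f i ^ 8) ^ ((1 : ℝ) / 4) * (∑ i ∈ s, g i ^ 12) ^ ((3 : ℝ) / 4) := by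
  have hc : (4 : ℝ).HolderConjugate (4 / 3) := by
    rw [Real.holderConjugate_iff]; norm_num
  have h := Real.inner_le_Lp_mul_Lq_of_nonneg s (f := fun i => f i ^ 2 * g i)
    (g := fun i => g i ^ 9) hc (fun i _ => mul_nonneg (pow_nonneg (hf i) 2) (hg i))
    (fun i _ => pow_nonneg (hg i) 9)
  have h1 : ∀ i, (f i ^ 2 * g i) ^ (4 : ℝ) = g i ^ 4 * f i ^ 8 := by
    intro i
    rw [show (4 : ℝ) = ((4 : ℕ) : ℝ) by norm_num, Real.rpow_natCast]
    ring
  have h2 : ∀ i, (g i ^ 9) ^ ((4 : ℝ) / 3) = g i ^ 12 := by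
    intro i
    rw [← Real.rpow_natCast, ← Real.rpow_mul (hg i), ← Real.rpow_natCast]
    norm_num
  have h3 : ∀ i, f i ^ 2 * g i * g i ^ 9 = f i ^ 2 * g i ^ 10 := fun i => by ring
  simp_rw [h1, h2, h3] at h
  rwa [show (1 : ℝ) / (4 / 3) = 3 / 4 by norm_num] at h

/-- The integers in `[1, X]` congruent to `r` modulo `q`. -/
noncomputable def residueFinset (X : ℝ) (q r : ℤ) : Finset ℕ :=
  {x ∈ Finset.Icc 1 ⌊X⌋₊ | (x : ℤ) ≡ r [ZMOD q]}

theorem mem_residueFinset {X : ℝ} {q r : ℤ} {x : ℕ} :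
    x ∈ residueFinset X q r ↔ (1 ≤ x ∧ (x : ℝ) ≤ X) ∧ (x : ℤ) ≡ r [ZMOD q] := by
  simp only [residueFinset, Finset.mem_filter, Finset.mem_Icc, and_congr_left_iff,
    and_congr_right_iff]
  intro _ hx
  exact Nat.le_floor_iff' (by omega)

/-- The point `(x, x², x³)` of the moment curve modulo `N`. -/
def momentCurve (N : ℕ) (x : ℕ) : Fin 3 → ZMod N := fun j => (x : ZMod N) ^ ((j : ℕ) + 1)

theorem sum_momentCurve_eq_iff {X : ℕ} {x y : Fin 6 → ℕ} (hx : ∀ i, x i ≤ X)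
    (hy : ∀ i, y i ≤ X) (hX : 1 ≤ X) :
    ∑ i, momentCurve (6 * X ^ 3 + 1) (x i) = ∑ i, momentCurve (6 * X ^ 3 + 1) (y i) ↔
      ∀ j ∈ Finset.Icc 1 3, ∑ i, x i ^ j = ∑ i, y i ^ j := by
  have bound : ∀ z : Fin 6 → ℕ, (∀ i, z i ≤ X) → ∀ j ≤ 3, ∑ i, z i ^ j < 6 * X ^ 3 + 1 := by
    intro z hz j hj
    have : ∑ i, z i ^ j ≤ ∑ _i : Fin 6, X ^ 3 := Finset.sum_le_sum fun i _ =>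
      (Nat.pow_le_pow_left (hz i) j).trans (Nat.pow_le_pow_right hX hj)
    simp at this
    omega
  have step : ∀ j : ℕ, j ≤ 3 →
      ((∑ i, (x i : ZMod (6 * X ^ 3 + 1)) ^ j = ∑ i, (y i : ZMod (6 * X ^ 3 + 1)) ^ j) ↔
        ∑ i, x i ^ j = ∑ i, y i ^ j) := by
    intro j hj
    constructor
    · intro h
      have h' : ((∑ i, x i ^ j : ℕ) : ZMod (6 * X ^ 3 + 1)) = (∑ i, y i ^ j : ℕ) := by
        push_cast
        exact h
      rw [ZMod.natCast_eq_natCast_iff] at h'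
      exact h'.eq_of_lt_of_lt (bound x hx j hj) (bound y hy j hj)
    · intro h
      exact_mod_cast congrArg (Nat.cast : ℕ → ZMod (6 * X ^ 3 + 1)) h
  constructor
  · intro h j hj
    rw [Finset.mem_Icc] at hj
    have := congrFun h ⟨j - 1, by omega⟩
    simp only [Finset.sum_apply, momentCurve, Nat.sub_add_cancel hj.1] at this
    exact (step j hj.2).1 this
  · intro h
    funext j
    simp only [Finset.sum_apply, momentCurve]
    exact (step _ (by omega)).2 (h _ (by rw [Finset.mem_Icc]; omega))

open Finset in
theorem Icount_eq_card {X : ℝ} (hX : 1 ≤ X) (p m a b : ℕ) (ξ η : ℤ) (S : Fin 6 → Finset ℕ)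
    (hS : ∀ i, S i = if (i : ℕ) < m then residueFinset X ((p : ℤ) ^ a) ξ
      else residueFinset X ((p : ℤ) ^ b) η) :
    Icount p X m a b ξ η = #{z ∈ Fintype.piFinset S ×ˢ Fintype.piFinset S |
        ∑ i, momentCurve (6 * ⌊X⌋₊ ^ 3 + 1) (z.1 i) =
          ∑ i, momentCurve (6 * ⌊X⌋₊ ^ 3 + 1) (z.2 i)} := by
  have hmem : ∀ (i : Fin 6) (x : ℕ), x ∈ S i ↔ (1 ≤ x ∧ (x : ℝ) ≤ X) ∧
      if (i : ℕ) < m then (x : ℤ) ≡ ξ [ZMOD (p : ℤ) ^ a]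
        else (x : ℤ) ≡ η [ZMOD (p : ℤ) ^ b] := by
    intro i x
    rw [hS]
    split_ifs <;> exact mem_residueFinset
  rw [Icount]
  refine Nat.subtype_card _ ?_
  rintro ⟨x, y⟩
  simp only [mem_filter, mem_product, Fintype.mem_piFinset, hmem, forall_and]
  constructor
  · rintro ⟨⟨⟨⟨h1, h2⟩, h3⟩, ⟨h4, h5⟩, h6⟩, h7⟩
    exact ⟨⟨h1, h2⟩, ⟨h4, h5⟩, (sum_momentCurve_eq_iff (fun i => Nat.le_floor (h2 i))
      (fun i => Nat.le_floor (h5 i)) (Nat.le_floor (by simpa using hX))).1 h7, h3, h6⟩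
  · rintro ⟨⟨h1, h2⟩, ⟨h4, h5⟩, h7, h3, h6⟩
    exact ⟨⟨⟨⟨h1, h2⟩, h3⟩, ⟨h4, h5⟩, h6⟩, (sum_momentCurve_eq_iff
      (fun i => Nat.le_floor (h2 i)) (fun i => Nat.le_floor (h5 i))
      (Nat.le_floor (by simpa using hX))).2 h7⟩

theorem prod_ite_val_lt_sq {m : ℕ} (hm : m ≤ 6) (u w : ℝ) :
    ∏ i : Fin 6, (if (i : ℕ) < m then u else w) ^ 2 = u ^ (2 * m) * w ^ (12 - 2 * m) := by
  interval_cases m <;> simp [Fin.prod_univ_six, -mul_eq_mul_right_iff] <;> ring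

theorem Icount_one_le {X : ℝ} (hX : 1 ≤ X) (p a b : ℕ) (ξ η : ℤ) :
    (Icount p X 1 a b ξ η : ℝ) ≤ (Icount p X 2 b a η ξ : ℝ) ^ ((1 : ℝ) / 4) *
      (Icount p X 0 a b 0 η : ℝ) ^ ((3 : ℝ) / 4) := by
  set N := 6 * ⌊X⌋₊ ^ 3 + 1 with hN
  have moment : ∀ (m a b : ℕ) (ξ η : ℤ), ∑ ψ : AddChar (Fin 3 → ZMod N) ℂ, ∏ i : Fin 6,
      (if (i : ℕ) < m then ‖∑ x ∈ residueFinset X ((p : ℤ) ^ a) ξ, ψ (momentCurve N x)‖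
        else ‖∑ x ∈ residueFinset X ((p : ℤ) ^ b) η, ψ (momentCurve N x)‖) ^ 2 =
      (Fintype.card (Fin 3 → ZMod N) : ℝ) * Icount p X m a b ξ η := by
    intro m a b ξ η
    rw [Icount_eq_card hX p m a b ξ η _ fun i => rfl, ← sum_prod_norm_sq_eq_card]
    refine Finset.sum_congr rfl fun ψ _ => Finset.prod_congr rfl fun i _ => ?_
    split_ifs <;> rfl
  set c : ℝ := (Fintype.card (Fin 3 → ZMod N) : ℝ) with hc
  have hcpos : 0 < c := by
    rw [hc]
    exact_mod_cast Fintype.card_pos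
  have h := sum_sq_mul_pow_ten_le (Finset.univ : Finset (AddChar (Fin 3 → ZMod N) ℂ))
    (fun ψ => ‖∑ x ∈ residueFinset X ((p : ℤ) ^ a) ξ, ψ (momentCurve N x)‖)
    (fun ψ => ‖∑ x ∈ residueFinset X ((p : ℤ) ^ b) η, ψ (momentCurve N x)‖)
    (fun _ => norm_nonneg _) (fun _ => norm_nonneg _)
  have e1 := moment 1 a b ξ η
  have e2 := moment 2 b a η ξ
  have e0 := moment 0 a b 0 η
  simp only [prod_ite_val_lt_sq (show 0 ≤ 6 by omega), prod_ite_val_lt_sq (show 1 ≤ 6 by omega),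
    prod_ite_val_lt_sq (show 2 ≤ 6 by omega)] at e1 e2 e0
  norm_num only [pow_zero, one_mul] at e1 e2 e0
  rw [e1, e2, e0, Real.mul_rpow hcpos.le (Nat.cast_nonneg _),
    Real.mul_rpow hcpos.le (Nat.cast_nonneg _), mul_mul_mul_comm, ← Real.rpow_add hcpos] at h
  norm_num only [Real.rpow_one] at h
  refine le_of_mul_le_mul_left ?_ hcpos
  norm_num only
  exact h

theorem sum_pow_eq_of_sum_affine_pow_eq {q d : ℤ} (hq : q ≠ 0) {u w : Fin 6 → ℤ}
    (h : ∀ j ∈ Finset.Icc 1 3, ∑ i, (q * u i + d) ^ j = ∑ i, (q * w i + d) ^ j) :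
    ∀ j ∈ Finset.Icc 1 3, ∑ i, u i ^ j = ∑ i, w i ^ j := by
  have h1 := h 1 (by simp)
  have h2 := h 2 (by simp)
  have h3 := h 3 (by simp)
  have g1 : ∑ i, u i ^ 1 = ∑ i, w i ^ 1 := by
    refine mul_left_cancel₀ hq ?_
    simp only [Fin.sum_univ_six] at *
    linear_combination h1
  have g2 : ∑ i, u i ^ 2 = ∑ i, w i ^ 2 := by
    refine mul_left_cancel₀ (pow_ne_zero 2 hq) ?_
    simp only [Fin.sum_univ_six] at *
    linear_combination h2 - 2 * q * d * g1
  have g3 : ∑ i, u i ^ 3 = ∑ i, w i ^ 3 := by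
    refine mul_left_cancel₀ (pow_ne_zero 3 hq) ?_
    simp only [Fin.sum_univ_six] at *
    linear_combination h3 - 3 * q ^ 2 * d * g2 - 3 * q * d ^ 2 * g1
  intro j hj
  rw [Finset.mem_Icc] at hj
  obtain ⟨hj1, hj3⟩ := hj
  interval_cases j
  exacts [g1, g2, g3]

theorem finite_Jcount_set (s k : ℕ) (X : ℝ) :
    {xy : (Fin s → ℕ) × (Fin s → ℕ) |
      (∀ i, 1 ≤ xy.1 i ∧ (xy.1 i : ℝ) ≤ X) ∧
      (∀ i, 1 ≤ xy.2 i ∧ (xy.2 i : ℝ) ≤ X) ∧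
      ∀ j ∈ Finset.Icc 1 k, ∑ i, xy.1 i ^ j = ∑ i, xy.2 i ^ j}.Finite := by
  refine ((Fintype.piFinset fun _ => Finset.Iic ⌊X⌋₊) ×ˢ
    (Fintype.piFinset fun _ => Finset.Iic ⌊X⌋₊)).finite_toSet.subset ?_
  rintro ⟨x, y⟩ ⟨hx, hy, -⟩
  simp only [Finset.coe_product, Set.mem_prod, Finset.mem_coe, Fintype.mem_piFinset,
    Finset.mem_Iic]
  exact ⟨fun i => Nat.le_floor (hx i).2, fun i => Nat.le_floor (hy i).2⟩

theorem Icount_le_Jcount (p : ℕ) (X : ℝ) (m a b : ℕ) (ξ η : ℤ) :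
    Icount p X m a b ξ η ≤ Jcount 6 3 X :=
  Nat.card_mono (finite_Jcount_set 6 3 X) fun _ h => ⟨h.1, h.2.1, h.2.2.1⟩

/-- Translation-dilation invariance of the Vinogradov system: solutions within a residue class
modulo `p ^ b` correspond to solutions in an interval shorter by a factor `p ^ b`. -/
theorem Icount_zero_le_Jcount {p b : ℕ} (hp : 0 < p) {X : ℝ} (hpb : (p : ℝ) ^ b ≤ X) (a : ℕ)
    (ξ η : ℤ) : Icount p X 0 a b ξ η ≤ Jcount 6 3 (2 * X / (p : ℝ) ^ b) := by
  set q := p ^ b with hq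
  have hqpos : 0 < q := pow_pos hp b
  have hqR : (p : ℝ) ^ b = q := by rw [hq]; push_cast; rfl
  have hqZ : (p : ℤ) ^ b = q := by rw [hq]; push_cast; rfl
  set d : ℤ := 1 + (η - 1) % q - q with hd
  have affine : ∀ x : ℕ, 1 ≤ x → (x : ℤ) ≡ η [ZMOD (p : ℤ) ^ b] →
      (x : ℤ) = q * (((x - 1) / q + 1 : ℕ) : ℤ) + d := by
    intro x hx hxη
    rw [hqZ] at hxη
    have h1 : ((x : ℤ) - 1) % q = (η - 1) % q := hxη.sub_right 1
    have h2 := Int.mul_ediv_add_emod ((x : ℤ) - 1) q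
    push_cast [Nat.cast_sub hx]
    linarith
  have bound : ∀ x : ℕ, 1 ≤ x → (x : ℝ) ≤ X →
      (((x - 1) / q + 1 : ℕ) : ℝ) ≤ 2 * X / (p : ℝ) ^ b := by
    intro x hx hxX
    have hq0 : (0 : ℝ) < q := by exact_mod_cast hqpos
    rw [hqR] at hpb ⊢
    rw [le_div_iff₀ hq0]
    have h : ((x - 1) / q + 1) * q ≤ x + q := by
      have := Nat.div_mul_le_self (x - 1) q
      rw [add_mul]
      omega
    have h' : (((x - 1) / q + 1 : ℕ) : ℝ) * q ≤ x + q := by exact_mod_cast h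
    linarith
  let φ : (Fin 6 → ℕ) × (Fin 6 → ℕ) → (Fin 6 → ℕ) × (Fin 6 → ℕ) :=
    fun z => (fun i => (z.1 i - 1) / q + 1, fun i => (z.2 i - 1) / q + 1)
  simp only [Icount, Jcount, not_lt_zero, if_false]
  refine @Nat.card_le_card_of_injective _ _ (finite_Jcount_set 6 3 _).to_subtype
    (fun z => ⟨φ z.1, ?_⟩) ?_
  · obtain ⟨⟨x, y⟩, hx, hy, hxy, hxη, hyη⟩ := z
    refine ⟨fun i => ⟨Nat.le_add_left 1 _, bound _ (hx i).1 (hx i).2⟩,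
      fun i => ⟨Nat.le_add_left 1 _, bound _ (hy i).1 (hy i).2⟩, ?_⟩
    have := sum_pow_eq_of_sum_affine_pow_eq (q := q) (d := d) (by exact_mod_cast hqpos.ne')
      (u := fun i => (((x i - 1) / q + 1 : ℕ) : ℤ)) (w := fun i => (((y i - 1) / q + 1 : ℕ) : ℤ))
      (by
        intro j hj
        simp only [← affine _ (hx _).1 (hxη _), ← affine _ (hy _).1 (hyη _)]
        exact_mod_cast hxy j hj)
    intro j hj
    exact_mod_cast this j hj
  · rintro ⟨⟨x, y⟩, hx, hy, _, hxη, hyη⟩ ⟨⟨x', y'⟩, hx', hy', _, hxη', hyη'⟩ h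
    have h := Prod.mk.inj (congrArg Subtype.val h)
    simp only [Subtype.mk.injEq, Prod.mk.injEq]
    constructor
    · funext i
      have e : (x i : ℤ) = q * (((x i - 1) / q + 1 : ℕ) : ℤ) + d :=
        affine _ (hx i).1 (hxη i)
      have hi : (x i - 1) / q + 1 = (x' i - 1) / q + 1 := congrFun h.1 i
      rw [hi, ← affine _ (hx' i).1 (hxη' i)] at e
      exact_mod_cast e
    · funext i
      have e : (y i : ℤ) = q * (((y i - 1) / q + 1 : ℕ) : ℤ) + d :=
        affine _ (hy i).1 (hyη i)
      have hi : (y i - 1) / q + 1 = (y' i - 1) / q + 1 := congrFun h.2 i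
      rw [hi, ← affine _ (hy' i).1 (hyη' i)] at e
      exact_mod_cast e

theorem Icount_le_Imax {p m : ℕ} (hm : m ≠ 0) (X : ℝ) (a b : ℕ) {ξ η : ℤ}
    (h : ¬ ξ ≡ η [ZMOD (p : ℤ)]) : Icount p X m a b ξ η ≤ Imax p X m a b := by
  rw [Imax, if_neg hm]
  refine le_csSup ⟨Jcount 6 3 X, ?_⟩ ⟨ξ, η, h, rfl⟩
  rintro _ ⟨ξ, η, -, rfl⟩
  exact Icount_le_Jcount ..

theorem exists_Imax_eq {p m : ℕ} (hp : 1 < p) (hm : m ≠ 0) (X : ℝ) (a b : ℕ) :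
    ∃ ξ η : ℤ, ¬ ξ ≡ η [ZMOD (p : ℤ)] ∧ Imax p X m a b = Icount p X m a b ξ η := by
  rw [Imax, if_neg hm]
  refine Nat.sSup_mem
    (s := {n | ∃ ξ η : ℤ, ¬ ξ ≡ η [ZMOD (p : ℤ)] ∧ n = Icount p X m a b ξ η}) ?_ ?_
  · refine ⟨_, 1, 0, ?_, rfl⟩
    rw [Int.modEq_zero_iff_dvd]
    intro h
    have := Int.le_of_dvd one_pos h
    omega
  · refine ⟨Jcount 6 3 X, ?_⟩
    rintro _ ⟨ξ, η, -, rfl⟩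
    exact Icount_le_Jcount ..

/-- Lemma 4: if `p^b ≤ X` then `I₁(X;a,b) ≤ I₂(X;b,a)^(1/4) · J(2X/p^b)^(3/4)`. -/
theorem I1_le_I2_J (p : ℕ) (hp : p.Prime) (hp5 : 5 ≤ p) (a b : ℕ) (ha : 1 ≤ a) (hb : 1 ≤ b)
    (X : ℝ) (hX : 1 ≤ X) (hpb : (p : ℝ) ^ b ≤ X) :
    (Imax p X 1 a b : ℝ) ≤
      (Imax p X 2 b a : ℝ) ^ ((1 : ℝ) / 4) *
        (Jcount 6 3 (2 * X / (p : ℝ) ^ b) : ℝ) ^ ((3 : ℝ) / 4) := by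
  obtain ⟨ξ, η, hne, hmax⟩ := exists_Imax_eq hp.one_lt one_ne_zero X a b
  rw [hmax]
  refine (Icount_one_le hX p a b ξ η).trans ?_
  gcongr
  · exact Icount_le_Imax two_ne_zero X b a fun h => hne h.symm
  · exact Icount_zero_le_Jcount hp.pos hpb a 0 η
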